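/- Let B=(1,b_2,...,b_k) with 1<b_2<...<b_k positive integers (k≥2) be an orderly sequence, and let c = max{O_B(r) : 0 ≤ r ≤ b_k−1} with c ≥ 2. Let h,d be positive integers with h ≥ ⌈d/(c−1)⌉. Then there exist nondecreasing sequences of nonnegative integers W_B=(w_0,...,w_{b_k−1}) and R_B=(r_0,...,r_{b_k−1}) with w_{b_k−1} − w_0 ≤ 1, such that for every positive integer a with gcd(a,d)=1 and a ≥ (c−1)b_k, writing j = a mod b_k and A(a) = (a, ha+d, ha+d b_2, ..., ha+d b_k), the Frobenius number satisfies g(A(a)) = (w_j h − 1)a + r_j d + (ha + b_k d)(⌊a/b_k⌋ − c + 1). -/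

import Mathlib

/-- `OB k b M` is the minimum of `x 1 + ⋯ + x k` over all nonnegative integer
solutions of `x 1 * b 1 + ⋯ + x k * b k = M`. -/
noncomputable def OB (k : ℕ) (b : ℕ → ℕ) (M : ℕ) : ℕ :=
  sInf {n : ℕ | ∃ x : ℕ → ℕ,
    (∑ i ∈ Finset.Icc 1 k, x i * b i) = M ∧ (∑ i ∈ Finset.Icc 1 k, x i) = n}

/-- `greedyCount b i M` is the number of parts used by the greedy algorithm
representing `M` using the coins `b 1 < b 2 < ⋯ < b i` (largest first). -/
def greedyCount (b : ℕ → ℕ) : ℕ → ℕ → ℕ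
  | 0, _ => 0
  | i + 1, M => M / b (i + 1) + greedyCount b i (M % b (i + 1))

theorem exists_OB_eq (k : ℕ) (b : ℕ → ℕ) (hk : 1 ≤ k) (hb1 : b 1 = 1) (M : ℕ) :
    ∃ x : ℕ → ℕ, (∑ i ∈ Finset.Icc 1 k, x i * b i) = M ∧
      (∑ i ∈ Finset.Icc 1 k, x i) = OB k b M := by
  have hne : {n : ℕ | ∃ x : ℕ → ℕ,
      (∑ i ∈ Finset.Icc 1 k, x i * b i) = M ∧ (∑ i ∈ Finset.Icc 1 k, x i) = n}.Nonempty :=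
    ⟨_, fun i => if i = 1 then M else 0, by simp [ite_mul, hk, hb1], rfl⟩
  exact Nat.sInf_mem hne

theorem OB_le (k : ℕ) (b x : ℕ → ℕ) :
    OB k b (∑ i ∈ Finset.Icc 1 k, x i * b i) ≤ ∑ i ∈ Finset.Icc 1 k, x i :=
  Nat.sInf_le ⟨x, rfl, rfl⟩

theorem eq_zero_of_OB_eq_zero (k : ℕ) (b : ℕ → ℕ) (hk : 1 ≤ k) (hb1 : b 1 = 1) {M : ℕ}
    (hM : OB k b M = 0) : M = 0 := by
  obtain ⟨x, hx, hx'⟩ := exists_OB_eq k b hk hb1 M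
  rw [hM, Finset.sum_eq_zero_iff] at hx'
  rw [← hx]
  exact Finset.sum_eq_zero fun i hi => by simp [hx' i hi]

theorem greedyCount_eq_div_add_mod (b : ℕ → ℕ) {k : ℕ} (hk : 1 ≤ k) (hb : 0 < b k) (M : ℕ) :
    greedyCount b k M = M / b k + greedyCount b k (M % b k) := by
  obtain ⟨k, rfl⟩ : ∃ n, k = n + 1 := ⟨k - 1, by omega⟩
  simp [greedyCount, Nat.div_eq_of_lt (Nat.mod_lt M hb)]

/-- The last maximizer of a function on an initial segment of `ℕ`. -/
theorem exists_last_argmax (f : ℕ → ℕ) {N : ℕ} (hN : 0 < N) :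
    ∃ r < N, ∀ p < N, f p ≤ f r ∧ (f p = f r → p ≤ r) := by
  induction N, hN using Nat.le_induction with
  | base => exact ⟨0, by simp, fun p hp => by simp [Nat.lt_one_iff.mp hp]⟩
  | succ N _ ih =>
    obtain ⟨r, hr, hmax⟩ := ih
    by_cases hle : f r ≤ f N
    · refine ⟨N, by omega, fun p hp => ⟨?_, fun _ => by omega⟩⟩
      rcases Nat.lt_succ_iff_lt_or_eq.mp hp with hp | rfl
      · exact (hmax p hp).1.trans hle
      · exact le_rfl
    · refine ⟨r, by omega, fun p hp => ?_⟩
      rcases Nat.lt_succ_iff_lt_or_eq.mp hp with hp | rfl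
      · exact hmax p hp
      · exact ⟨by omega, fun _ => by omega⟩

section DivAddMod

variable {O : ℕ → ℕ} {β : ℕ}

theorem add_mul_of_div_add_mod (hβ : 0 < β) (hO : ∀ M, O M = M / β + O (M % β)) (M m : ℕ) :
    O (M + m * β) = O M + m := by
  rw [hO (M + m * β), hO M, Nat.add_mul_div_right _ _ hβ, Nat.add_mul_mod_self_right]
  ring

theorem le_add_of_div_add_mod {c a : ℕ} (hβ : 0 < β) (hO : ∀ M, O M = M / β + O (M % β))
    (hO0 : ∀ M, O M = 0 → M = 0) (hOc : ∀ s < β, O s ≤ c) (ha : (c - 1) * β ≤ a) (M : ℕ) :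
    O M ≤ O (M + a) := by
  obtain ⟨t, rfl⟩ := Nat.exists_eq_add_of_le ha
  rw [show M + ((c - 1) * β + t) = M + t + (c - 1) * β by ring, add_mul_of_div_add_mod hβ hO]
  have hdiv : M / β ≤ (M + t) / β := Nat.div_le_div_right (by omega)
  have hM := hO M
  have hMt := hO (M + t)
  have hc := hOc _ (Nat.mod_lt M hβ)
  by_cases hz : O ((M + t) % β) = 0
  · have hmod := hO0 _ hz
    rcases hdiv.lt_or_eq with hlt | heq
    · omega
    · have h1 := Nat.div_add_mod M β
      have h2 := Nat.div_add_mod (M + t) β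
      rw [← heq] at h2
      obtain rfl : t = 0 := by omega
      simp
  · omega

theorem weight_le_of_last_argmax {c a h d ρ : ℕ} (hβ : 0 < β)
    (hO : ∀ M, O M = M / β + O (M % β)) (hc2 : 2 ≤ c) (ha : (c - 1) * β ≤ a)
    (hdh : d ≤ (c - 1) * h)
    (hmax : ∀ p < (c - 1) * β + a % β, O p ≤ O ρ ∧ (O p = O ρ → p ≤ ρ))
    {e : ℕ} (he : a / β = e + (c - 1)) {s : ℕ} (hs : s < a) :
    h * a * O s + d * s ≤ h * a * (O ρ + e) + d * (ρ + e * β) := by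
  have hβc : β ≤ (c - 1) * β := Nat.le_mul_of_pos_left _ (by omega)
  have haeq : a = e * β + ((c - 1) * β + a % β) := by
    conv_lhs => rw [← Nat.div_add_mod a β, he]
    ring
  obtain ⟨p, hp, hOp, hsp⟩ : ∃ p < (c - 1) * β + a % β, O s ≤ O p + e ∧ s ≤ p + e * β := by
    by_cases hse : e * β ≤ s
    · obtain ⟨p, rfl⟩ := Nat.exists_eq_add_of_le' hse
      exact ⟨p, by omega, (add_mul_of_div_add_mod hβ hO p e).le, le_rfl⟩
    · have hlt := Nat.mod_lt s hβ
      have hse' : s / β < e := (Nat.div_lt_iff_lt_mul hβ).mpr (by omega)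
      exact ⟨s % β, by omega, by rw [hO s]; omega, by omega⟩
  have hlast : (c - 1) * β + a % β ≤ ρ + β := by
    by_contra! hlt
    have h1 := (hmax _ hlt).1
    have h2 := add_mul_of_div_add_mod hβ hO ρ 1
    rw [one_mul] at h2
    omega
  have hha : d * β ≤ h * a :=
    calc d * β ≤ (c - 1) * h * β := Nat.mul_le_mul_right _ hdh
      _ = h * ((c - 1) * β) := by ring
      _ ≤ h * a := Nat.mul_le_mul_left _ ha
  have hmain : h * a * O p + d * p ≤ h * a * O ρ + d * ρ := by
    rcases (hmax p hp).1.lt_or_eq with hlt | heq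
    · calc h * a * O p + d * p ≤ h * a * O p + d * (ρ + β) := by gcongr; omega
        _ = h * a * O p + d * β + d * ρ := by ring
        _ ≤ h * a * O p + h * a + d * ρ := by gcongr
        _ = h * a * (O p + 1) + d * ρ := by ring
        _ ≤ h * a * O ρ + d * ρ := by gcongr; omega
    · rw [heq]
      gcongr
      exact (hmax p hp).2 heq
  calc h * a * O s + d * s ≤ h * a * (O p + e) + d * (p + e * β) := by gcongr
    _ = h * a * O p + d * p + (h * a * e + d * (e * β)) := by ring
    _ ≤ h * a * O ρ + d * ρ + (h * a * e + d * (e * β)) := by gcongr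
    _ = _ := by ring

end DivAddMod

theorem sum_mul_weight (k h a d : ℕ) (b x : ℕ → ℕ) :
    ∑ i ∈ Finset.Icc 1 k, x i * (h * a + d * b i) =
      h * a * ∑ i ∈ Finset.Icc 1 k, x i + d * ∑ i ∈ Finset.Icc 1 k, x i * b i := by
  rw [Finset.mul_sum, Finset.mul_sum, ← Finset.sum_add_distrib]
  exact Finset.sum_congr rfl fun i _ => by ring

/-- If `s` maximizes `h * a * OB k b s + d * s` among the residues modulo `a`, and adding `a` never
decreases `OB k b`, then this maximum minus `a` is the Frobenius number. -/
theorem isGreatest_not_representable {k a h d σ : ℕ} {b : ℕ → ℕ} (hk : 1 ≤ k) (hb1 : b 1 = 1)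
    (ha : 0 < a) (hgcd : Nat.gcd a d = 1) (hσ : σ < a)
    (hadd : ∀ M, OB k b M ≤ OB k b (M + a))
    (hmax : ∀ s < a, h * a * OB k b s + d * s ≤ h * a * OB k b σ + d * σ) :
    IsGreatest {n : ℤ | ¬ ∃ x0 : ℕ, ∃ x : ℕ → ℕ,
        n = ((x0 * a + ∑ i ∈ Finset.Icc 1 k, x i * (h * a + d * b i) : ℕ) : ℤ)}
      (((h * a * OB k b σ + d * σ : ℕ) : ℤ) - a) := by
  constructor
  · rintro ⟨x0, x, hx⟩
    rw [sum_mul_weight] at hx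
    have hle := OB_le k b x
    set M := ∑ i ∈ Finset.Icc 1 k, x i * b i
    set X := ∑ i ∈ Finset.Icc 1 k, x i
    have hmod : d * M ≡ d * σ [MOD a] := by
      rw [← Int.natCast_modEq_iff, Int.modEq_iff_dvd]
      refine ⟨(x0 : ℤ) + h * X + 1 - h * OB k b σ, ?_⟩
      push_cast at hx ⊢
      linarith
    have hmod' : M ≡ σ [MOD a] := Nat.ModEq.cancel_left_of_coprime hgcd hmod
    obtain ⟨m, hm⟩ : ∃ m, M = σ + m * a := by
      refine ⟨M / a, ?_⟩
      have h1 : M % a = σ := by rw [hmod', Nat.mod_eq_of_lt hσ]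
      have h2 := Nat.mod_add_div M a
      rw [← h1, mul_comm]
      exact h2.symm
    have hmono : ∀ m, OB k b σ ≤ OB k b (σ + m * a) := by
      intro m
      induction m with
      | zero => simp
      | succ m ih => exact ih.trans (by simpa [add_mul, add_assoc] using hadd (σ + m * a))
    have h1 : OB k b σ ≤ X := (hmono m).trans (hm ▸ hle)
    have h2 : h * a * OB k b σ + d * σ ≤ h * a * X + d * M := by
      gcongr
      omega
    omega
  · intro n hn
    by_contra! hlt
    apply hn
    obtain ⟨u, hu⟩ : ∃ u : ℤ, (a : ℤ) ∣ n - d * u := by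
      have hbez := Nat.gcd_eq_gcd_ab a d
      rw [hgcd] at hbez
      refine ⟨Nat.gcdB a d * n, Nat.gcdA a d * n, ?_⟩
      push_cast at hbez
      linear_combination n * hbez
    have ha' : (0 : ℤ) < a := by exact_mod_cast ha
    obtain ⟨s, hs⟩ := Int.eq_ofNat_of_zero_le (Int.emod_nonneg u ha'.ne')
    have hsa : s < a := by
      have := Int.emod_lt_of_pos u ha'
      omega
    obtain ⟨x, hx, hx'⟩ := exists_OB_eq k b hk hb1 s
    have hle := hmax s hsa
    obtain ⟨t, ht⟩ : (a : ℤ) ∣ n - ((h * a * OB k b s + d * s : ℕ) : ℤ) := by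
      obtain ⟨v, hv⟩ := hu
      refine ⟨v + d * (u / a) - h * OB k b s, ?_⟩
      have hdm := Int.emod_add_mul_ediv u a
      rw [hs] at hdm
      push_cast
      linear_combination hv - d * hdm
    have ht0 : 0 ≤ t := by
      by_contra! hneg
      have : (a : ℤ) * t ≤ a * (-1) := mul_le_mul_of_nonneg_left (by omega) ha'.le
      omega
    lift t to ℕ using ht0
    refine ⟨t, x, ?_⟩
    rw [sum_mul_weight, hx, hx']
    push_cast at ht ⊢
    linarith

theorem stmt_9 (k : ℕ) (b : ℕ → ℕ) (hk : 2 ≤ k) (hb1 : b 1 = 1)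
    (hmono : ∀ i, 1 ≤ i → i < k → b i < b (i + 1))
    (horderly : ∀ M : ℕ, OB k b M = greedyCount b k M)
    (c : ℕ) (hc : c = (Finset.range (b k)).sup fun r => OB k b r) (hc2 : 2 ≤ c)
    (h d : ℕ) (hh : 0 < h) (hd : 0 < d) (hhd : d ⌈/⌉ (c - 1) ≤ h) :
    ∃ w r : ℕ → ℕ,
      (∀ i j, i ≤ j → j < b k → w i ≤ w j) ∧
      (∀ i j, i ≤ j → j < b k → r i ≤ r j) ∧
      w (b k - 1) - w 0 ≤ 1 ∧
      ∀ a : ℕ, 0 < a → Nat.gcd a d = 1 → (c - 1) * b k ≤ a →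
        IsGreatest {n : ℤ | ¬ ∃ x0 : ℕ, ∃ x : ℕ → ℕ,
            n = ((x0 * a + ∑ i ∈ Finset.Icc 1 k, x i * (h * a + d * b i) : ℕ) : ℤ)}
          (((w (a % b k) : ℤ) * h - 1) * a + (r (a % b k) : ℤ) * d
            + ((h : ℤ) * a + (b k : ℤ) * d) * (((a / b k : ℕ) : ℤ) - c + 1)) := by
  have hk1 : 1 ≤ k := by omega
  have hβ : 0 < b k := by
    have := hmono (k - 1) (by omega) (by omega)
    rw [Nat.sub_add_cancel hk1] at this
    omega
  have hO : ∀ M, OB k b M = M / b k + OB k b (M % b k) := fun M => by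
    rw [horderly, horderly, ← greedyCount_eq_div_add_mod b hk1 hβ]
  have hOc : ∀ s < b k, OB k b s ≤ c := fun s hs => by
    rw [hc]
    exact Finset.le_sup (f := fun r => OB k b r) (Finset.mem_range.mpr hs)
  have hdh : d ≤ (c - 1) * h := by
    simpa using (ceilDiv_le_iff_le_smul (show 0 < c - 1 by omega)).mp hhd
  have hβc : b k ≤ (c - 1) * b k := Nat.le_mul_of_pos_left _ (by omega)
  choose r hr hmax using fun j : ℕ =>
    exists_last_argmax (OB k b) (N := (c - 1) * b k + j) (by omega)
  refine ⟨fun j => OB k b (r j), r, ?_, ?_, ?_, ?_⟩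
  · intro i j hij _
    exact (hmax j (r i) (by have := hr i; omega)).1
  · intro i j hij _
    have hi := hr i
    by_contra! hlt
    have h1 := hmax i (r j) (by omega)
    have h2 := hmax j (r i) (by omega)
    have := h2.2 (le_antisymm h2.1 h1.1)
    omega
  · by_cases hlt : r (b k - 1) < b k
    · have := (hmax 0 (r (b k - 1)) (by omega)).1
      simp only
      omega
    · have h1 := hr (b k - 1)
      have h2 := (hmax 0 (r (b k - 1) - b k) (by omega)).1
      have h3 := add_mul_of_div_add_mod hβ hO (r (b k - 1) - b k) 1
      rw [one_mul, Nat.sub_add_cancel (by omega)] at h3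
      simp only
      omega
  · intro a ha hgcd hab
    obtain ⟨e, he⟩ : ∃ e, a / b k = e + (c - 1) :=
      Nat.exists_eq_add_of_le' ((Nat.le_div_iff_mul_le hβ).mpr hab)
    have hσ : r (a % b k) + e * b k < a := by
      have h1 := hr (a % b k)
      have h2 : a = e * b k + ((c - 1) * b k + a % b k) := by
        conv_lhs => rw [← Nat.div_add_mod a (b k), he]
        ring
      omega
    convert isGreatest_not_representable hk1 hb1 ha hgcd hσ
      (le_add_of_div_add_mod hβ hO (fun M => eq_zero_of_OB_eq_zero k b hk1 hb1) hOc hab)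
      (fun s hs => ?_) using 1
    · rw [he, add_mul_of_div_add_mod hβ hO]
      push_cast [Nat.cast_sub (show 1 ≤ c by omega)]
      ring
    · rw [add_mul_of_div_add_mod hβ hO]
      exact weight_le_of_last_argmax hβ hO hc2 hab hdh (hmax _) he hs
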